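/- Let a be a real number with 0 < a ≤ 1/3 and let A, B, C be nonnegative real numbers satisfying the three constraints: (1) A + [2a⁴(3a+1)/((6a²−1)(a+1)³)]·B + [2a⁴(3a−1)/((6a²−1)(a−1)³)]·C ≥ 0; (2) A + (a/(1+a))·B + (a/(a−1))·C ≥ 0; (3) A(A−1) ≤ B + C. Then A ≤ (1 − 3a²)/(2a⁴), and consequently 1 + A ≤ (1/2)(1/a² − 2)(1/a² − 1). -/

import Mathlib

/-- the algebraic core of the proof of the main bound on
equiangular lines. -/
theorem sdp_relaxation_core
    (a A B C : ℝ) (ha0 : 0 < a) (ha : a ≤ 1 / 3)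
    (hA : 0 ≤ A) (hB : 0 ≤ B) (hC : 0 ≤ C)
    (h1 : 0 ≤ A + (2 * a ^ 4 * (3 * a + 1) / ((6 * a ^ 2 - 1) * (a + 1) ^ 3)) * B
            + (2 * a ^ 4 * (3 * a - 1) / ((6 * a ^ 2 - 1) * (a - 1) ^ 3)) * C)
    (h2 : 0 ≤ A + (a / (1 + a)) * B + (a / (a - 1)) * C)
    (h3 : A * (A - 1) ≤ B + C) :
    A ≤ (1 - 3 * a ^ 2) / (2 * a ^ 4) ∧
      1 + A ≤ (1 / 2) * (1 / a ^ 2 - 2) * (1 / a ^ 2 - 1) := by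
  have hs : a ^ 2 ≤ 1 / 9 := by nlinarith
  have e1 : 0 < 1 - 5 * a ^ 2 := by linarith
  have e2 : 6 * a ^ 2 - 1 ≠ 0 := by intro h; linarith
  have e3 : a + 1 ≠ 0 := by positivity
  have e3' : 1 + a ≠ 0 := by positivity
  have e4 : a - 1 ≠ 0 := by intro h; linarith
  have e5 : a ≠ 0 := ha0.ne'
  have e6 : 1 - 5 * a ^ 2 ≠ 0 := e1.ne'
  have e7 : 1 - a ^ 2 * 5 ≠ 0 := by rw [mul_comm]; exact e6
  have e8 : a ^ 2 * 6 - 1 ≠ 0 := by rw [mul_comm]; exact e2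
  have hl : 0 ≤ (1 - a ^ 2) ^ 2 * (1 - 6 * a ^ 2) / (2 * a ^ 4 * (1 - 5 * a ^ 2)) := by
    apply div_nonneg
    · apply mul_nonneg (sq_nonneg _); linarith
    · positivity
  have hm : 0 ≤ 8 * a ^ 2 / (1 - 5 * a ^ 2) := by positivity
  have k1 := mul_nonneg hl h1
  have k2 := mul_nonneg hm h2
  -- coefficients of the dual combination of the two linear constraints
  have cB : (1 - a ^ 2) ^ 2 * (1 - 6 * a ^ 2) / (2 * a ^ 4 * (1 - 5 * a ^ 2)) *
      (2 * a ^ 4 * (3 * a + 1) / ((6 * a ^ 2 - 1) * (a + 1) ^ 3))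
      + 8 * a ^ 2 / (1 - 5 * a ^ 2) * (a / (1 + a)) = -1 := by
    rw [add_comm 1 a]
    field_simp
    ring
  have cC : (1 - a ^ 2) ^ 2 * (1 - 6 * a ^ 2) / (2 * a ^ 4 * (1 - 5 * a ^ 2)) *
      (2 * a ^ 4 * (3 * a - 1) / ((6 * a ^ 2 - 1) * (a - 1) ^ 3))
      + 8 * a ^ 2 / (1 - 5 * a ^ 2) * (a / (a - 1)) = -1 := by
    field_simp
    ring
  have cA : (1 - a ^ 2) ^ 2 * (1 - 6 * a ^ 2) / (2 * a ^ 4 * (1 - 5 * a ^ 2))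
      + 8 * a ^ 2 / (1 - 5 * a ^ 2) = (1 - 3 * a ^ 2) / (2 * a ^ 4) - 1 := by
    field_simp
    ring
  have key : B + C ≤ ((1 - 3 * a ^ 2) / (2 * a ^ 4) - 1) * A := by
    linear_combination k1 + k2 + B * cB + C * cC + A * cA
  have hpos : 0 ≤ (1 - 3 * a ^ 2) / (2 * a ^ 4) := by
    apply div_nonneg
    · linarith
    · positivity
  have main : A ≤ (1 - 3 * a ^ 2) / (2 * a ^ 4) := by
    by_contra hlt
    push Not at hlt
    have hApos : 0 < A := lt_of_le_of_lt hpos hlt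
    nlinarith [mul_pos hApos (sub_pos.mpr hlt)]
  refine ⟨main, ?_⟩
  have e : (1 / 2) * (1 / a ^ 2 - 2) * (1 / a ^ 2 - 1)
      = (1 - 3 * a ^ 2) / (2 * a ^ 4) + 1 := by
    field_simp
    ring
  linarith
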